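/- arXiv:1111.3343 — 4 statements merged into one kernel-verified Lean document; each statement's English description precedes it below -/
import Mathlib

section
/- Let w : [0,∞) → [0,∞) be nonincreasing, finite on (0,∞) and locally integrable, with ∫₀^t w(s) ds > 0 for all sufficiently large t, and suppose that for every u ≥ 0 one has ∫₀^{t−u} w(s) ds / ∫₀^t w(s) ds → 1 as t → ∞. Let f : [0,∞) → ℝ be continuous and such that the improper integral I := lim_{T→∞} ∫₀^T f(u) du exists and is finite. Then ∫₀^t (f ⋆ w)(s) ds / ∫₀^t w(s) ds → I as t → ∞. -/
open MeasureTheory Filter Topology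

/-- Fubini for an integrated convolution product: integrating `f ⋆ w` over `[0, t]` amounts to
convolving the primitive of `f` with `w`. -/
theorem integral_convolution_eq_integral_primitive_mul {f w : ℝ → ℝ} {t : ℝ} (ht : 0 ≤ t)
    (hf : Continuous f) (hw : IntegrableOn w (Set.Ioc 0 t)) :
    ∫ s in (0:ℝ)..t, ∫ u in (0:ℝ)..s, f u * w (s - u) =
      ∫ v in (0:ℝ)..t, (∫ u in (0:ℝ)..(t - v), f u) * w v := by
  set K : ℝ → ℝ → ℝ := fun s v => {p : ℝ × ℝ | p.2 < p.1}.indicator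
    (fun p => f (p.1 - p.2)) (s, v) * w v with hK
  have hmeas : MeasurableSet {p : ℝ × ℝ | p.2 < p.1} :=
    measurableSet_lt measurable_snd measurable_fst
  obtain ⟨M, hM⟩ := (isCompact_Icc (a := (0:ℝ)) (b := t)).exists_bound_of_continuousOn
    hf.continuousOn
  have hM0 : 0 ≤ M := (norm_nonneg _).trans (hM 0 ⟨le_rfl, ht⟩)
  have hint : Integrable (Function.uncurry K)
      ((volume.restrict (Set.Ioc 0 t)).prod (volume.restrict (Set.Ioc 0 t))) := by
    refine Integrable.bdd_mul (c := M) (hw.comp_snd _) ?_ ?_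
    · exact ((hf.measurable.comp (measurable_fst.sub measurable_snd)).indicator
        hmeas).aestronglyMeasurable
    · rw [Measure.prod_restrict]
      filter_upwards [ae_restrict_mem (measurableSet_Ioc.prod measurableSet_Ioc)] with p hp
      obtain ⟨⟨h1, h2⟩, h3, h4⟩ := hp
      by_cases h : p.2 < p.1
      · simpa [Set.indicator, h] using hM (p.1 - p.2) ⟨by linarith, by linarith⟩
      · simpa [Set.indicator, h] using hM0
  have hswap := integral_integral_swap hint
  rw [intervalIntegral.integral_of_le ht, intervalIntegral.integral_of_le ht]
  convert hswap using 1
  · refine setIntegral_congr_fun measurableSet_Ioc fun s hs => ?_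
    have hsub : Set.Ioc 0 t ∩ Set.Iio s = Set.Ioo 0 s := by
      ext v; simp only [Set.mem_inter_iff, Set.mem_Ioc, Set.mem_Iio, Set.mem_Ioo]
      exact ⟨fun h => ⟨h.1.1, h.2⟩, fun h => ⟨⟨h.1, h.2.le.trans hs.2⟩, h.2⟩⟩
    have hKs : K s = (Set.Iio s).indicator fun v => f (s - v) * w v := by
      ext v
      by_cases h : v < s <;> simp [hK, Set.indicator, h]
    rw [hKs, setIntegral_indicator measurableSet_Iio, hsub, ← integral_Ioc_eq_integral_Ioo,
      ← intervalIntegral.integral_of_le hs.1.le]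
    simpa using (intervalIntegral.integral_comp_sub_left
      (fun v => f (s - v) * w v) s (a := 0) (b := s))
  · refine setIntegral_congr_fun measurableSet_Ioc fun v hv => ?_
    have hsub : Set.Ioc 0 t ∩ Set.Ioi v = Set.Ioc v t := by
      ext s; simp only [Set.mem_inter_iff, Set.mem_Ioc, Set.mem_Ioi]
      exact ⟨fun h => ⟨h.2, h.1.2⟩, fun h => ⟨⟨hv.1.trans h.1, h.2⟩, h.1⟩⟩
    have hKv : (fun s => K s v) = (Set.Ioi v).indicator fun s => f (s - v) * w v := by
      ext s
      by_cases h : v < s <;> simp [hK, Set.indicator, h]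
    simp only [hKv]
    rw [setIntegral_indicator measurableSet_Ioi, hsub,
      ← intervalIntegral.integral_of_le hv.2, intervalIntegral.integral_mul_const,
      intervalIntegral.integral_comp_sub_right f v, sub_self]

/-- A weighted average of `v ↦ F (t - v)` over `[0, t]` converges to the limit of `F` at infinity
if the weight of a window of bounded length at the right end of `[0, t]` is asymptotically
negligible. -/
theorem tendsto_integral_comp_sub_mul_div {F w : ℝ → ℝ} {I : ℝ}
    (hF : Continuous F) (hFI : Tendsto F atTop (𝓝 I))
    (hw_nonneg : ∀ t, 0 ≤ t → 0 ≤ w t)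
    (hw_int : ∀ t, 0 ≤ t → IntervalIntegrable w volume 0 t)
    (hw_pos : ∀ᶠ t in atTop, 0 < ∫ s in (0:ℝ)..t, w s)
    (hw_tail : ∀ u : ℝ, 0 ≤ u →
      Tendsto (fun t : ℝ => (∫ s in (0:ℝ)..(t - u), w s) / (∫ s in (0:ℝ)..t, w s))
        atTop (𝓝 1)) :
    Tendsto (fun t : ℝ => (∫ v in (0:ℝ)..t, F (t - v) * w v) / (∫ s in (0:ℝ)..t, w s))
      atTop (𝓝 I) := by
  rw [Metric.tendsto_nhds]
  intro ε hε
  obtain ⟨A, hA0, hA⟩ : ∃ A : ℝ, 0 ≤ A ∧ ∀ x, A ≤ x → |F x - I| ≤ ε / 2 := by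
    obtain ⟨A, hA⟩ := eventually_atTop.1 (Metric.tendsto_nhds.1 hFI (ε / 2) (half_pos hε))
    exact ⟨max A 0, le_max_right _ _, fun x hx => (hA x ((le_max_left _ _).trans hx)).le⟩
  obtain ⟨M, hM⟩ := (isCompact_Icc (a := (0:ℝ)) (b := A)).exists_bound_of_continuousOn
    (hF.sub (continuous_const (y := I))).continuousOn
  have hlim : Tendsto (fun t : ℝ =>
      ε / 2 * ((∫ s in (0:ℝ)..(t - A), w s) / (∫ s in (0:ℝ)..t, w s)) +
      M * (1 - (∫ s in (0:ℝ)..(t - A), w s) / (∫ s in (0:ℝ)..t, w s))) atTop (𝓝 (ε / 2)) := by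
    simpa using ((hw_tail A hA0).const_mul (ε / 2)).add
      (((hw_tail A hA0).const_sub 1).const_mul M)
  filter_upwards [hw_pos, eventually_ge_atTop A, hlim.eventually_lt_const (half_lt_self hε)]
    with t hpos htA hlt
  refine lt_of_le_of_lt ?_ hlt
  have htA' : 0 ≤ t - A := sub_nonneg.2 htA
  have ht0 : 0 ≤ t := hA0.trans htA
  have hw1 := hw_int _ htA'
  have hw2 : IntervalIntegrable w volume (t - A) t := hw1.symm.trans (hw_int t ht0)
  have hcont : Continuous fun v => F (t - v) - I := by fun_prop
  have hd1 := hw1.continuousOn_mul hcont.continuousOn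
  have hd2 := hw2.continuousOn_mul hcont.continuousOn
  have hdiff : (∫ v in (0:ℝ)..t, F (t - v) * w v) - I * ∫ s in (0:ℝ)..t, w s =
      (∫ v in (0:ℝ)..(t - A), (F (t - v) - I) * w v) +
        ∫ v in (t - A)..t, (F (t - v) - I) * w v := by
    rw [intervalIntegral.integral_add_adjacent_intervals hd1 hd2,
      ← intervalIntegral.integral_const_mul, ← intervalIntegral.integral_sub
        ((hw_int t ht0).continuousOn_mul (by fun_prop)) ((hw_int t ht0).const_mul I)]
    simp only [sub_mul]
  have hb1 : ‖∫ v in (0:ℝ)..(t - A), (F (t - v) - I) * w v‖ ≤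
      ε / 2 * ∫ s in (0:ℝ)..(t - A), w s := by
    rw [← intervalIntegral.integral_const_mul]
    refine intervalIntegral.norm_integral_le_of_norm_le htA' (ae_of_all _ fun v hv => ?_)
      (hw1.const_mul _)
    rw [norm_mul, Real.norm_of_nonneg (hw_nonneg v hv.1.le)]
    exact mul_le_mul_of_nonneg_right (hA _ (by linarith [hv.2])) (hw_nonneg v hv.1.le)
  have hb2 : ‖∫ v in (t - A)..t, (F (t - v) - I) * w v‖ ≤
      M * ∫ s in (t - A)..t, w s := by
    rw [← intervalIntegral.integral_const_mul]
    refine intervalIntegral.norm_integral_le_of_norm_le (by linarith)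
      (ae_of_all _ fun v hv => ?_) (hw2.const_mul _)
    have hv0 : 0 ≤ v := htA'.trans hv.1.le
    rw [norm_mul, Real.norm_of_nonneg (hw_nonneg v hv0)]
    exact mul_le_mul_of_nonneg_right (hM _ ⟨by linarith [hv.2], by linarith [hv.1]⟩)
      (hw_nonneg v hv0)
  rw [← intervalIntegral.integral_interval_sub_left (hw_int t ht0) hw1] at hb2
  rw [Real.dist_eq, div_sub' hpos.ne', abs_div, abs_of_pos hpos, div_le_iff₀ hpos,
    mul_comm _ I, hdiff]
  refine (abs_add_le _ _).trans ((add_le_add hb1 hb2).trans_eq ?_)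
  field_simp

/-- Lemma 3.3 of the paper: asymptotics of an integrated convolution product.
If `w : [0,∞) → [0,∞)` is nonincreasing, locally integrable, with eventually
positive integral `∫₀^t w` satisfying `∫₀^{t-u} w / ∫₀^t w → 1` for every `u ≥ 0`,
and `f` is continuous on `[0,∞)` with convergent improper integral `I`, then
`∫₀^t (f ⋆ w)(s) ds / ∫₀^t w(s) ds → I` as `t → ∞`, where
`(f ⋆ w)(s) = ∫₀^s f(u) w(s-u) du`. -/
theorem integrated_convolution_asymptotics
    (w f : ℝ → ℝ) (I : ℝ)
    (hw_nonneg : ∀ t, 0 ≤ t → 0 ≤ w t)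
    (hw_mono : ∀ ⦃s t : ℝ⦄, 0 ≤ s → s ≤ t → w t ≤ w s)
    (hw_loc : ∀ t : ℝ, IntegrableOn w (Set.Icc 0 t))
    (hw_pos : ∀ᶠ t in atTop, 0 < ∫ s in (0:ℝ)..t, w s)
    (hw_tail : ∀ u : ℝ, 0 ≤ u →
      Tendsto (fun t : ℝ => (∫ s in (0:ℝ)..(t - u), w s) / (∫ s in (0:ℝ)..t, w s))
        atTop (𝓝 1))
    (hf_cont : ContinuousOn f (Set.Ici 0))
    (hf_int : Tendsto (fun T : ℝ => ∫ u in (0:ℝ)..T, f u) atTop (𝓝 I)) :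
    Tendsto
      (fun t : ℝ =>
        (∫ s in (0:ℝ)..t, ∫ u in (0:ℝ)..s, f u * w (s - u)) / (∫ s in (0:ℝ)..t, w s))
      atTop (𝓝 I) := by
  have hw_int : ∀ t, 0 ≤ t → IntervalIntegrable w volume 0 t := fun t ht =>
    (intervalIntegrable_iff_integrableOn_Icc_of_le ht).2 (hw_loc t)
  have hg : Continuous fun x => f (max x 0) :=
    hf_cont.comp_continuous (by fun_prop) fun x => le_max_right x 0
  have hprim : ∀ T, 0 ≤ T → ∫ u in (0:ℝ)..T, f (max u 0) = ∫ u in (0:ℝ)..T, f u := by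
    intro T hT
    refine intervalIntegral.integral_congr fun u hu => ?_
    rw [Set.uIcc_of_le hT] at hu
    simp only [max_eq_left hu.1]
  have hlim : Tendsto (fun T : ℝ => ∫ u in (0:ℝ)..T, f (max u 0)) atTop (𝓝 I) :=
    hf_int.congr' ((eventually_ge_atTop 0).mono fun T hT => (hprim T hT).symm)
  refine (tendsto_integral_comp_sub_mul_div
    (intervalIntegral.continuous_primitive (fun a b => hg.intervalIntegrable a b) 0)
    hlim hw_nonneg hw_int hw_pos hw_tail).congr' ?_
  filter_upwards [eventually_ge_atTop 0] with t ht
  rw [← integral_convolution_eq_integral_primitive_mul ht hg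
    ((hw_loc t).mono_set Set.Ioc_subset_Icc_self)]
  congr 1
  refine intervalIntegral.integral_congr fun s hs => ?_
  rw [Set.uIcc_of_le ht] at hs
  refine intervalIntegral.integral_congr fun u hu => ?_
  rw [Set.uIcc_of_le hs.1] at hu
  simp only [max_eq_left hu.1]
end

section
/- Let w : [0,∞) → [0,∞) be nonincreasing, finite on (0,∞) and locally integrable, with ∫₀^t w(s) ds → ∞ as t → ∞, and such that for every A ≥ 0, ∫₀^{t−A} w(s) ds / ∫₀^t w(s) ds → 1 as t → ∞. Let f : [0,∞) → [0,∞) be measurable, bounded on compact sets, and such that f(t) → 1 as t → ∞. Then ∫₀^t f(s) w(t−s) ds / ∫₀^t w(s) ds → 1 as t → ∞. -/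
open MeasureTheory Filter Topology

/-- The reflection `s ↦ w (t - s)` of a locally integrable function is interval integrable
between points of `(-∞, t]`. -/
theorem intervalIntegrable_comp_sub_left_of_integrableOn_Icc {w : ℝ → ℝ}
    (hw : ∀ t : ℝ, IntegrableOn w (Set.Icc 0 t)) {a b t : ℝ} (hab : a ≤ b) (hbt : b ≤ t) :
    IntervalIntegrable (fun s => w (t - s)) volume a b := by
  have h : IntervalIntegrable w volume (t - a) (t - b) := by
    refine IntervalIntegrable.symm ?_
    rw [intervalIntegrable_iff_integrableOn_Icc_of_le (by linarith)]
    exact (hw (t - a)).mono_set (Set.Icc_subset_Icc (by linarith) le_rfl)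
  simpa using h.comp_sub_left t

/-- Weighted convolution bound: if `|g| ≤ M` on `(0, A]` and `|g| ≤ ε` on `(A, t]`, then
`∫₀ᵗ g(s) w(t - s) ds` is controlled by the integrals of `w` over `[t - A, t]` and `[0, t - A]`. -/
theorem abs_integral_mul_comp_sub_left_le {w g : ℝ → ℝ} {A t M ε : ℝ}
    (hw_nonneg : ∀ t, 0 ≤ t → 0 ≤ w t) (hw : ∀ t : ℝ, IntegrableOn w (Set.Icc 0 t))
    (hA : 0 ≤ A) (hAt : A ≤ t)
    (hg : IntervalIntegrable (fun s => g s * w (t - s)) volume 0 t)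
    (hM : ∀ s ∈ Set.Ioc 0 A, |g s| ≤ M) (hε : ∀ s ∈ Set.Ioc A t, |g s| ≤ ε) :
    |∫ s in (0:ℝ)..t, g s * w (t - s)| ≤
      M * ((∫ s in (0:ℝ)..t, w s) - ∫ s in (0:ℝ)..(t - A), w s) +
        ε * ∫ s in (0:ℝ)..(t - A), w s := by
  have hint : ∀ r, 0 ≤ r → IntervalIntegrable w volume 0 r := fun r hr =>
    (intervalIntegrable_iff_integrableOn_Icc_of_le hr).2 (hw r)
  have bound : ∀ {a b K : ℝ}, a ≤ b → b ≤ t → (∀ s ∈ Set.Ioc a b, |g s| ≤ K) →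
      |∫ s in a..b, g s * w (t - s)| ≤ K * ∫ s in (t - b)..(t - a), w s := by
    intro a b K hab hbt hK
    rw [← intervalIntegral.integral_comp_sub_left (fun s => w s) t,
      ← intervalIntegral.integral_const_mul, ← Real.norm_eq_abs]
    refine intervalIntegral.norm_integral_le_of_norm_le hab (ae_of_all _ fun s hs => ?_)
      ((intervalIntegrable_comp_sub_left_of_integrableOn_Icc hw hab hbt).const_mul K)
    have hnonneg : 0 ≤ w (t - s) := hw_nonneg _ (by linarith [hs.2])
    rw [Real.norm_eq_abs, abs_mul, abs_of_nonneg hnonneg]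
    exact mul_le_mul_of_nonneg_right (hK s hs) hnonneg
  have h₁ := bound hA hAt hM
  have h₂ := bound hAt le_rfl hε
  rw [sub_zero, ← intervalIntegral.integral_interval_sub_left (hint t (hA.trans hAt))
    (hint (t - A) (by linarith))] at h₁
  rw [sub_self] at h₂
  rw [← intervalIntegral.integral_add_adjacent_intervals
    (hg.mono_set (by
      rw [Set.uIcc_of_le hA, Set.uIcc_of_le (hA.trans hAt)]
      exact Set.Icc_subset_Icc le_rfl hAt))
    (hg.mono_set (by
      rw [Set.uIcc_of_le hAt, Set.uIcc_of_le (hA.trans hAt)]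
      exact Set.Icc_subset_Icc hA le_rfl))]
  exact (abs_add_le _ _).trans (add_le_add h₁ h₂)

/-- Key analytic step in Lemma 3.5 of the paper: if `w : [0,∞) → [0,∞)` is
nonincreasing, locally integrable, with `∫₀^t w(s) ds → ∞` and
`∫₀^{t-A} w / ∫₀^t w → 1` for every `A ≥ 0`, and if `f : [0,∞) → [0,∞)` is
measurable, bounded on compact sets, with `f(t) → 1` as `t → ∞`, then
`∫₀^t f(s) w(t-s) ds / ∫₀^t w(s) ds → 1` as `t → ∞`. -/
theorem convolution_with_converging_density_asymptotics
    (w f : ℝ → ℝ)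
    (hw_nonneg : ∀ t, 0 ≤ t → 0 ≤ w t)
    (hw_mono : ∀ ⦃s t : ℝ⦄, 0 ≤ s → s ≤ t → w t ≤ w s)
    (hw_loc : ∀ t : ℝ, IntegrableOn w (Set.Icc 0 t))
    (hw_div : Tendsto (fun t : ℝ => ∫ s in (0:ℝ)..t, w s) atTop atTop)
    (hw_tail : ∀ A : ℝ, 0 ≤ A →
      Tendsto (fun t : ℝ => (∫ s in (0:ℝ)..(t - A), w s) / (∫ s in (0:ℝ)..t, w s))
        atTop (𝓝 1))
    (hf_meas : Measurable f)
    (hf_nonneg : ∀ t, 0 ≤ t → 0 ≤ f t)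
    (hf_bdd : ∀ r : ℝ, ∃ C : ℝ, ∀ x ∈ Set.Icc (0:ℝ) r, f x ≤ C)
    (hf_lim : Tendsto f atTop (𝓝 1)) :
    Tendsto
      (fun t : ℝ => (∫ s in (0:ℝ)..t, f s * w (t - s)) / (∫ s in (0:ℝ)..t, w s))
      atTop (𝓝 1) := by
  have hfw : ∀ t, 0 ≤ t → IntervalIntegrable (fun s => f s * w (t - s)) volume 0 t := by
    intro t ht
    obtain ⟨C, hC⟩ := hf_bdd t
    have hw_int := intervalIntegrable_comp_sub_left_of_integrableOn_Icc hw_loc ht le_rfl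
    rw [intervalIntegrable_iff_integrableOn_Icc_of_le ht] at hw_int ⊢
    refine hw_int.bdd_mul (c := C) hf_meas.aestronglyMeasurable ?_
    filter_upwards [ae_restrict_mem measurableSet_Icc] with s hs
    rw [Real.norm_eq_abs, abs_of_nonneg (hf_nonneg s hs.1)]
    exact hC s hs
  rw [Metric.tendsto_nhds]
  intro ε hε
  obtain ⟨A₀, hA₀⟩ := eventually_atTop.1 (Metric.tendsto_nhds.1 hf_lim (ε / 2) (half_pos hε))
  set A := max A₀ 0
  have hA : 0 ≤ A := le_max_right _ _
  obtain ⟨C, hC⟩ := hf_bdd A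
  have hlim : Tendsto (fun t : ℝ =>
      (|C| + 1) * (1 - (∫ s in (0:ℝ)..(t - A), w s) / (∫ s in (0:ℝ)..t, w s)) +
        ε / 2 * ((∫ s in (0:ℝ)..(t - A), w s) / (∫ s in (0:ℝ)..t, w s)))
      atTop (𝓝 (ε / 2)) := by
    simpa using (((hw_tail A hA).const_sub 1).const_mul (|C| + 1)).add
      ((hw_tail A hA).const_mul (ε / 2))
  filter_upwards [hlim.eventually_lt_const (half_lt_self hε), hw_div.eventually_gt_atTop 0,
    eventually_ge_atTop A] with t hlt hpos hAt
  have ht : 0 ≤ t := hA.trans hAt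
  have hw_int := intervalIntegrable_comp_sub_left_of_integrableOn_Icc hw_loc ht le_rfl
  have hsub : ∀ s, (f s - 1) * w (t - s) = f s * w (t - s) - w (t - s) := fun s => by ring
  have hg : IntervalIntegrable (fun s => (f s - 1) * w (t - s)) volume 0 t := by
    simpa only [hsub] using (hfw t ht).sub hw_int
  have hbound := abs_integral_mul_comp_sub_left_le (M := |C| + 1) (ε := ε / 2)
    hw_nonneg hw_loc hA hAt hg
    (fun s hs => by
      have h₀ := hf_nonneg s hs.1.le
      have h₁ := hC s ⟨hs.1.le, hs.2⟩
      rw [abs_le]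
      constructor <;> linarith [le_abs_self C, abs_nonneg C])
    (fun s hs => (hA₀ s ((le_max_left _ _).trans hs.1.le)).le)
  have heq : ∫ s in (0:ℝ)..t, (f s - 1) * w (t - s) =
      (∫ s in (0:ℝ)..t, f s * w (t - s)) - ∫ s in (0:ℝ)..t, w s := by
    simp only [hsub]
    rw [intervalIntegral.integral_sub (hfw t ht) hw_int,
      intervalIntegral.integral_comp_sub_left (fun s => w s), sub_self, sub_zero]
  rw [heq] at hbound
  rw [Real.dist_eq, div_sub_one hpos.ne', abs_div, abs_of_pos hpos]
  refine ((div_le_div_iff_of_pos_right hpos).2 hbound).trans_lt (lt_of_eq_of_lt ?_ hlt)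
  field_simp
end

section
/- Let (Ω, F, P) be a probability space equipped with a filtration (F_s)_{s≥0}, and let (Γ_t)_{t≥0} be a nonnegative measurable process with 0 < E[Γ_t] < ∞ for every t > 0. Fix s ≥ 0 and suppose that E[Γ_t | F_s] / E[Γ_t] converges almost surely, as t → ∞, to a random variable M_s satisfying E[M_s] = 1. Then for every Λ ∈ F_s, E[1_Λ Γ_t] / E[Γ_t] → E[M_s 1_Λ] as t → ∞. -/
open MeasureTheory Filter Topology

/-- **Scheffé's lemma**: if functions that are nonnegative almost everywhere converge almost
everywhere to an integrable limit and their integrals converge to the integral of the limit, then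
they converge in `L¹`. -/
theorem tendsto_integral_abs_sub_of_tendsto_integral {α ι : Type*} {m : MeasurableSpace α}
    {μ : Measure α} {l : Filter ι} [l.IsCountablyGenerated] {F : ι → α → ℝ} {f : α → ℝ}
    (hF_int : ∀ᶠ i in l, Integrable (F i) μ) (hF_nonneg : ∀ᶠ i in l, 0 ≤ᵐ[μ] F i)
    (hf : Integrable f μ) (h_lim : ∀ᵐ a ∂μ, Tendsto (fun i => F i a) l (𝓝 (f a)))
    (h_integral : Tendsto (fun i => ∫ a, F i a ∂μ) l (𝓝 (∫ a, f a ∂μ))) :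
    Tendsto (fun i => ∫ a, |F i a - f a| ∂μ) l (𝓝 0) := by
  have h_pos_part : Tendsto (fun i => ∫ a, max (f a - F i a) 0 ∂μ) l (𝓝 0) := by
    suffices Tendsto (fun i => ∫ a, max (f a - F i a) 0 ∂μ) l (𝓝 (∫ _, (0 : ℝ) ∂μ)) by
      simpa using this
    refine tendsto_integral_filter_of_dominated_convergence (fun a => |f a|) ?_ ?_ hf.abs ?_
    · filter_upwards [hF_int] with i hi
      exact (hf.sub hi).pos_part.aestronglyMeasurable
    · filter_upwards [hF_nonneg] with i hi
      filter_upwards [hi] with a ha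
      rw [Real.norm_of_nonneg (le_max_right _ _)]
      exact max_le ((sub_le_self _ ha).trans (le_abs_self _)) (abs_nonneg _)
    · filter_upwards [h_lim] with a ha
      simpa using (ha.const_sub (f a)).max (tendsto_const_nhds (x := (0 : ℝ)))
  have h_sum := (h_pos_part.const_mul 2).add (h_integral.sub_const (∫ a, f a ∂μ))
  rw [sub_self, mul_zero, add_zero] at h_sum
  refine h_sum.congr' ?_
  filter_upwards [hF_int] with i hi
  have h_pos_part_int : Integrable (fun a => 2 * max (f a - F i a) 0) μ :=
    (hf.sub hi).pos_part.const_mul 2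
  have h_sub_int : Integrable (fun a => F i a - f a) μ := hi.sub hf
  rw [← integral_const_mul, ← integral_sub hi hf, ← integral_add h_pos_part_int h_sub_int]
  refine integral_congr_ae (ae_of_all _ fun a => ?_)
  grind

/-- Part (i) of the meta-theorem (Theorem 4.1 of the paper, due to
Roynette–Vallois–Yor): if `(Γ_t)` is a nonnegative measurable process with
`0 < E[Γ_t] < ∞` for `t > 0`, and if for a fixed `s ≥ 0` the ratios
`E[Γ_t | F_s] / E[Γ_t]` converge a.s. as `t → ∞` to a random variable `M_s`
with `E[M_s] = 1`, then for every `Λ ∈ F_s`,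
`E[1_Λ Γ_t] / E[Γ_t] → E[M_s 1_Λ]`. -/
theorem meta_theorem_part_one
    {Ω : Type*} {m0 : MeasurableSpace Ω} (P : Measure Ω) [IsProbabilityMeasure P]
    (ℱ : Filtration ℝ m0) (Γ : ℝ → Ω → ℝ)
    (hΓ_meas : ∀ t : ℝ, Measurable (Γ t))
    (hΓ_nonneg : ∀ (t : ℝ) (ω : Ω), 0 ≤ Γ t ω)
    (hΓ_int : ∀ t : ℝ, 0 < t → Integrable (Γ t) P)
    (hΓ_pos : ∀ t : ℝ, 0 < t → 0 < ∫ ω, Γ t ω ∂P)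
    (s : ℝ) (hs : 0 ≤ s) (M : Ω → ℝ)
    (hM_int : Integrable M P) (hM_mean : ∫ ω, M ω ∂P = 1)
    (h_conv : ∀ᵐ ω ∂P,
      Tendsto (fun t : ℝ => (P[Γ t | ℱ s]) ω / ∫ ω', Γ t ω' ∂P) atTop (𝓝 (M ω))) :
    ∀ Λ : Set Ω, MeasurableSet[ℱ s] Λ →
      Tendsto (fun t : ℝ => (∫ ω in Λ, Γ t ω ∂P) / ∫ ω, Γ t ω ∂P)
        atTop (𝓝 (∫ ω in Λ, M ω ∂P)) := by
  intro Λ hΛ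
  have h_integrable (t : ℝ) :
      Integrable (fun ω => (P[Γ t | ℱ s]) ω / ∫ ω', Γ t ω' ∂P) P :=
    integrable_condExp.div_const _
  have h_nonneg (t : ℝ) : 0 ≤ᵐ[P] fun ω => (P[Γ t | ℱ s]) ω / ∫ ω', Γ t ω' ∂P := by
    filter_upwards [condExp_nonneg (m := ℱ s) (ae_of_all P (hΓ_nonneg t))] with ω hω
    exact div_nonneg hω (integral_nonneg (hΓ_nonneg t))
  have h_mean : Tendsto (fun t : ℝ => ∫ ω, (P[Γ t | ℱ s]) ω / ∫ ω', Γ t ω' ∂P ∂P) atTop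
      (𝓝 (∫ ω, M ω ∂P)) := by
    refine tendsto_const_nhds.congr' ?_
    filter_upwards [eventually_gt_atTop 0] with t ht
    rw [integral_div, integral_condExp (ℱ.le s), div_self (hΓ_pos t ht).ne', hM_mean]
  have h_L1 := tendsto_integral_abs_sub_of_tendsto_integral
    (Eventually.of_forall h_integrable) (Eventually.of_forall h_nonneg) hM_int h_conv h_mean
  have h_set : Tendsto (fun t : ℝ => ∫ ω in Λ, (P[Γ t | ℱ s]) ω / ∫ ω', Γ t ω' ∂P ∂P) atTop
      (𝓝 (∫ ω in Λ, M ω ∂P)) := by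
    rw [tendsto_iff_norm_sub_tendsto_zero]
    refine squeeze_zero (fun _ => norm_nonneg _) (fun t => ?_) h_L1
    have h_diff := (h_integrable t).sub hM_int
    rw [← integral_sub (h_integrable t).integrableOn hM_int.integrableOn]
    exact (norm_integral_le_integral_norm _).trans
      (setIntegral_le_integral h_diff.norm (ae_of_all _ fun _ => norm_nonneg _))
  refine h_set.congr' ?_
  filter_upwards [eventually_gt_atTop 0] with t ht
  rw [integral_div, setIntegral_condExp (ℱ.le s) (hΓ_int t ht) hΛ]
end

section
/- Let Ω = C([0,∞), [0,∞)) be the canonical space of continuous paths with coordinate process (X_t)_{t≥0}, natural filtration F_s = σ(X_u, u ≤ s), and F_∞ = σ(⋃_{s≥0} F_s), and let P be a probability measure on (Ω, F_∞). Let (Γ_t)_{t≥0} be a nonnegative measurable process with 0 < E[Γ_t] < ∞ for every t > 0, and suppose that for every s ≥ 0 the ratio E[Γ_t | F_s] / E[Γ_t] converges almost surely, as t → ∞, to a random variable M_s with E[M_s] = 1. Then there exists a probability measure Q on (Ω, F_∞) such that for every s ≥ 0 and every Λ ∈ F_s, Q(Λ) = E[M_s 1_Λ]. -/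
open MeasureTheory Filter Topology

noncomputable section

/-- The canonical space `Ω = C([0,∞), [0,∞))` of continuous paths with values
in `[0,∞)`. -/
abbrev PathSpace : Type := C(NNReal, NNReal)

/-- The natural filtration `F_s = σ(X_u, u ≤ s)` of the coordinate process
`X_u ω = ω u` on the canonical path space. -/
def natFiltration (s : NNReal) : MeasurableSpace PathSpace :=
  ⨆ u ∈ Set.Iic s, MeasurableSpace.comap (fun ω : PathSpace => ω u) inferInstance

/-- The terminal σ-algebra `F_∞ = σ(⋃_{s ≥ 0} F_s)`. -/
def Finfty : MeasurableSpace PathSpace := ⨆ s : NNReal, natFiltration s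

instance : MeasurableSpace PathSpace := Finfty

open Set ENNReal NNReal

lemma natFiltration_le (s : ℝ≥0) : natFiltration s ≤ Finfty := le_iSup natFiltration s

lemma natFiltration_mono : Monotone natFiltration :=
  fun _ _ hst ↦ biSup_mono fun _ hu ↦ le_trans hu hst

lemma measurable_eval_natFiltration {u s : ℝ≥0} (hus : u ≤ s) :
    Measurable[natFiltration s] fun ω : PathSpace ↦ ω u :=
  Measurable.of_comap_le <| le_iSup₂_of_le u hus le_rfl

lemma measurable_eval (u : ℝ≥0) : Measurable fun ω : PathSpace ↦ ω u :=
  (measurable_eval_natFiltration le_rfl).mono (natFiltration_le u) le_rfl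

lemma finfty_le_of_measurable_eval {m : MeasurableSpace PathSpace}
    (h : ∀ u : ℝ≥0, Measurable[m] fun ω : PathSpace ↦ ω u) : Finfty ≤ m :=
  iSup_le fun _ ↦ iSup₂_le fun u _ ↦ (h u).comap_le

lemma measurableSet_mapsTo {K U : Set ℝ≥0} (hK : IsCompact K) (hU : IsOpen U) :
    MeasurableSet {ω : PathSpace | MapsTo ω K U} := by
  obtain ⟨D, hD, hDdense⟩ := TopologicalSpace.exists_countable_dense K
  have key : {ω : PathSpace | MapsTo ω K U} =
      ⋃ n : ℕ, ⋂ d ∈ D, (fun ω : PathSpace ↦ ω (d : ℝ≥0)) ⁻¹'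
        (Metric.thickening (1 / (n + 1 : ℝ)) Uᶜ)ᶜ := by
    ext ω
    simp only [mem_ofPred_eq, mem_iUnion, mem_iInter, mem_preimage, mem_compl_iff,
      Metric.mem_thickening_iff, not_exists, not_and, not_lt]
    constructor
    · intro h
      obtain ⟨δ, hδ, hsub⟩ := (hK.image ω.continuous).exists_thickening_subset_open hU
        h.image_subset
      obtain ⟨n, hn⟩ := exists_nat_one_div_lt hδ
      refine ⟨n, fun d _ z hz ↦ ?_⟩
      by_contra! hlt
      refine hz (hsub (Metric.mem_thickening_iff.2 ⟨ω d, mem_image_of_mem _ d.2, ?_⟩))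
      rw [dist_comm]
      exact hlt.trans hn
    · rintro ⟨n, hn⟩ x hx
      by_contra hxU
      have hopen : IsOpen {y : K | dist (ω y) (ω x) < 1 / (n + 1 : ℝ)} :=
        isOpen_lt (by fun_prop) continuous_const
      obtain ⟨d, hdist, hdD⟩ := hDdense.inter_open_nonempty _ hopen
        ⟨⟨x, hx⟩, by simpa using by positivity⟩
      exact absurd hdist (not_lt.2 (hn d hdD (ω x) hxU))
  rw [key]
  exact .iUnion fun n ↦ .biInter hD fun d _ ↦
    measurable_eval d Metric.isOpen_thickening.measurableSet.compl

instance : BorelSpace PathSpace where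
  measurable_eq := by
    apply le_antisymm
    · exact finfty_le_of_measurable_eval fun u ↦
        Measurable.mono (ContinuousEvalConst.continuous_eval_const u).borel_measurable
          le_rfl BorelSpace.measurable_eq.le
    · rw [borel_eq_generateFrom_of_subbasis ContinuousMap.compactOpen_eq]
      refine MeasurableSpace.generateFrom_le ?_
      rintro _ ⟨K, hK, U, hU, rfl⟩
      exact measurableSet_mapsTo hK hU

/-- The path stopped at the deterministic time `s`. -/
def stopPath (s : ℝ≥0) (ω : PathSpace) : PathSpace :=
  ω.comp ⟨fun u ↦ min u s, by fun_prop⟩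

@[simp] lemma stopPath_apply (s : ℝ≥0) (ω : PathSpace) (u : ℝ≥0) :
    stopPath s ω u = ω (min u s) := rfl

lemma continuous_stopPath (s : ℝ≥0) : Continuous (stopPath s) :=
  ContinuousMap.continuous_precomp _

lemma measurable_stopPath (s : ℝ≥0) : Measurable (stopPath s) :=
  (continuous_stopPath s).measurable

lemma stopPath_comp_stopPath {s t : ℝ≥0} (hst : s ≤ t) :
    stopPath s ∘ stopPath t = stopPath s := by
  ext ω u
  simp [hst]

lemma natFiltration_le_invariants {s t : ℝ≥0} (hst : s ≤ t) :
    natFiltration s ≤ MeasurableSpace.invariants (stopPath t) := by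
  refine iSup₂_le fun u hu ↦ ?_
  rintro _ ⟨A, hA, rfl⟩
  refine ⟨measurable_eval u hA, ?_⟩
  ext ω
  simp [min_eq_left (le_trans hu hst)]

lemma stopPath_preimage_eq {s t : ℝ≥0} (hst : s ≤ t) {Λ : Set PathSpace}
    (hΛ : MeasurableSet[natFiltration s] Λ) : stopPath t ⁻¹' Λ = Λ :=
  (natFiltration_le_invariants hst Λ hΛ).2

lemma measurableSet_stopPath_preimage (s : ℝ≥0) {Λ : Set PathSpace} (hΛ : MeasurableSet Λ) :
    MeasurableSet[natFiltration s] (stopPath s ⁻¹' Λ) := by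
  have h : Finfty ≤ MeasurableSpace.map (stopPath s) (natFiltration s) :=
    finfty_le_of_measurable_eval fun u A hA ↦
      measurable_eval_natFiltration (min_le_right u s) hA
  exact h Λ hΛ

lemma isCompact_iInter_stopPath_preimage {K : ℕ → Set PathSpace} (hK : ∀ n, IsCompact (K n)) :
    IsCompact (⋂ n : ℕ, stopPath n ⁻¹' K n) := by
  have hclosed : IsClosed (⋂ n : ℕ, stopPath n ⁻¹' K n) :=
    isClosed_iInter fun n ↦ (hK n).isClosed.preimage (continuous_stopPath n)
  refine isCompact_iff_ultrafilter_le_nhds.2 fun l hl ↦ ?_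
  obtain ⟨ω, hω⟩ : ∃ ω, Tendsto (fun x : PathSpace ↦ x) l (𝓝 ω) := by
    refine (ContinuousMap.exists_tendsto_compactOpen_iff_forall _).2 fun S hS ↦ ?_
    obtain ⟨b, hb⟩ := hS.bddAbove
    obtain ⟨n, hn⟩ := exists_nat_ge b
    obtain ⟨x, -, hx⟩ := (hK n).ultrafilter_le_nhds (l.map (stopPath n)) <| by
      refine le_principal_iff.2 (Ultrafilter.mem_map.2 ?_)
      exact mem_of_superset (le_principal_iff.1 hl) (iInter_subset _ n)
    refine ⟨x.restrict S, ?_⟩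
    have hlim : Tendsto (fun y ↦ (stopPath n y).restrict S) l (𝓝 (x.restrict S)) :=
      ContinuousMap.tendsto_compactOpen_restrict hx S
    refine hlim.congr fun y ↦ ?_
    ext u
    simp [min_eq_left ((hb u.2).trans hn)]
  exact ⟨ω, hclosed.mem_of_tendsto hω (le_principal_iff.1 hl), hω⟩

lemma isTightMeasureSet_range_of_map_stopPath {ν : ℕ → Measure PathSpace}
    [∀ n, IsFiniteMeasure (ν n)]
    (hν : ∀ n m : ℕ, n ≤ m → (ν m).map (stopPath n) = ν n) :
    IsTightMeasureSet (range ν) := by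
  refine isTightMeasureSet_iff_exists_isCompact_measure_compl_le.2 fun ε hε ↦ ?_
  obtain ⟨δ, hδ, hδsum⟩ := ENNReal.exists_pos_sum_of_countable hε.ne' ℕ
  have htight (n m : ℕ) : ∃ K : Set PathSpace, IsCompact K ∧
      (ν m).map (stopPath n) Kᶜ ≤ δ n := by
    obtain ⟨K, hK, hKle⟩ := isTightMeasureSet_iff_exists_isCompact_measure_compl_le.1
      (isTightMeasureSet_singleton (μ := (ν m).map (stopPath n))) (δ n) (by simpa using hδ n)
    exact ⟨K, hK, hKle _ rfl⟩
  choose K hK hKle using htight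
  let L (n : ℕ) : Set PathSpace := ⋃ m ∈ Iic n, K n m
  have hL (n : ℕ) : IsCompact (L n) := (finite_Iic n).isCompact_biUnion fun m _ ↦ hK n m
  have hKL {n m : ℕ} (h : m ≤ n) : K n m ⊆ L n :=
    subset_biUnion_of_mem (u := fun m ↦ K n m) (mem_Iic.2 h)
  have hLle (n m : ℕ) : (ν m).map (stopPath n) (L n)ᶜ ≤ δ n := by
    rcases le_total m n with h | h
    · exact (measure_mono (compl_subset_compl.2 (hKL h))).trans (hKle n m)
    · rw [hν n m h, ← hν n n le_rfl]
      exact (measure_mono (compl_subset_compl.2 (hKL le_rfl))).trans (hKle n n)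
  refine ⟨_, isCompact_iInter_stopPath_preimage hL, ?_⟩
  rintro _ ⟨m, rfl⟩
  rw [compl_iInter]
  calc ν m (⋃ n : ℕ, (stopPath n ⁻¹' L n)ᶜ)
      ≤ ∑' n : ℕ, ν m (stopPath n ⁻¹' L n)ᶜ := measure_iUnion_le _
    _ ≤ ∑' n, (δ n : ℝ≥0∞) := ENNReal.tsum_le_tsum fun n ↦ by
        rw [← preimage_compl, ← Measure.map_apply (measurable_stopPath n)
          (hL n).measurableSet.compl]
        exact hLle n m
    _ ≤ ε := hδsum.le

/-- Extension of a family of stopped path laws that is consistent under stopping. -/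
lemma exists_probabilityMeasure_map_stopPath_eq (ν : ℕ → ProbabilityMeasure PathSpace)
    (hν : ∀ n m : ℕ, n ≤ m →
      (ν m : Measure PathSpace).map (stopPath n) = ν n) :
    ∃ Q : ProbabilityMeasure PathSpace, ∀ n : ℕ,
      (Q : Measure PathSpace).map (stopPath n) = ν n := by
  have hcompact : IsCompact (closure (range ν)) := by
    refine isCompact_closure_of_isTightMeasureSet ?_
    convert isTightMeasureSet_range_of_map_stopPath hν using 1
    ext μ
    simp
  obtain ⟨Q, -, hQ⟩ := hcompact.ultrafilter_le_nhds ((hyperfilter ℕ).map ν) <|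
    le_principal_iff.2 <| Ultrafilter.mem_map.2 <| univ_mem' fun n ↦
      subset_closure (mem_range_self n)
  refine ⟨Q, fun n ↦ ?_⟩
  have hlim := ProbabilityMeasure.tendsto_map_of_tendsto_of_continuous ν Q hQ
    (continuous_stopPath n)
  have hev : ∀ᶠ m in (hyperfilter ℕ : Filter ℕ),
      (ν m).map (measurable_stopPath n).aemeasurable = ν n := by
    filter_upwards [Nat.hyperfilter_le_atTop (eventually_ge_atTop n)] with m hm
    exact Subtype.ext (hν n m hm)
  have hmap : Q.map (measurable_stopPath n).aemeasurable = ν n :=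
    tendsto_nhds_unique hlim (tendsto_const_nhds.congr' (hev.mono fun _ h ↦ h.symm))
  exact congrArg ProbabilityMeasure.toMeasure hmap

/-- Scheffé's lemma. -/
lemma tendsto_lintegral_enorm_sub_of_integral_eq {α : Type*} {m : MeasurableSpace α}
    {μ : Measure α} {f : ℕ → α → ℝ} {g : α → ℝ} (hf : ∀ n, Integrable (f n) μ)
    (hf0 : ∀ n, 0 ≤ᵐ[μ] f n) (hg : Integrable g μ)
    (hlim : ∀ᵐ x ∂μ, Tendsto (fun n ↦ f n x) atTop (𝓝 (g x)))
    (hint : ∀ n, ∫ x, f n x ∂μ = ∫ x, g x ∂μ) :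
    Tendsto (fun n ↦ ∫⁻ x, ‖f n x - g x‖ₑ ∂μ) atTop (𝓝 0) := by
  have hpos : Tendsto (fun n ↦ ∫ x, max (g x - f n x) 0 ∂μ) atTop (𝓝 (∫ _, (0 : ℝ) ∂μ)) := by
    refine tendsto_integral_of_dominated_convergence (fun x ↦ |g x|)
      (fun n ↦ (hg.sub (hf n)).pos_part.aestronglyMeasurable) hg.abs (fun n ↦ ?_) ?_
    · filter_upwards [hf0 n] with x hx
      rw [Real.norm_eq_abs, abs_of_nonneg (le_max_right _ _)]
      exact max_le (by linarith [le_abs_self (g x), show 0 ≤ f n x from hx]) (abs_nonneg _)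
    · filter_upwards [hlim] with x hx
      simpa using (hx.const_sub (g x)).max (tendsto_const_nhds (x := (0 : ℝ)))
  have habs (n : ℕ) : ∫ x, ‖f n x - g x‖ ∂μ = 2 * ∫ x, max (g x - f n x) 0 ∂μ := by
    have hpt (x : α) : ‖f n x - g x‖ = 2 * max (g x - f n x) 0 + (f n x - g x) := by
      rw [Real.norm_eq_abs]
      rcases le_total (f n x) (g x) with h | h
      · rw [max_eq_left (by linarith), abs_of_nonpos (by linarith)]; ring
      · rw [max_eq_right (by linarith), abs_of_nonneg (by linarith)]; ring
    have hpart : Integrable (fun x ↦ max (g x - f n x) 0) μ := (hg.sub (hf n)).pos_part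
    have hsub : Integrable (fun x ↦ f n x - g x) μ := (hf n).sub hg
    simp_rw [hpt]
    rw [integral_add (hpart.const_mul 2) hsub, integral_const_mul,
      integral_sub (hf n) hg, hint n, sub_self, add_zero]
  have hconv : Tendsto (fun n ↦ ENNReal.ofReal (∫ x, ‖f n x - g x‖ ∂μ)) atTop (𝓝 0) := by
    simp_rw [habs]
    simpa using ENNReal.tendsto_ofReal (hpos.const_mul 2)
  exact hconv.congr fun n ↦ ofReal_integral_norm_eq_lintegral_enorm ((hf n).sub hg)

/-- Part (ii) of the meta-theorem (Theorem 4.1 of the paper, due to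
Roynette–Vallois–Yor): on the canonical space of continuous paths equipped with
its natural filtration, if `(Γ_t)` is a nonnegative measurable process with
`0 < E[Γ_t] < ∞` for every `t > 0` and, for every `s ≥ 0`, the ratio
`E[Γ_t | F_s] / E[Γ_t]` converges a.s. as `t → ∞` to `M_s` with `E[M_s] = 1`,
then there exists a probability measure `Q` on `(Ω, F_∞)` such that
`Q(Λ) = E[M_s 1_Λ]` for every `s ≥ 0` and `Λ ∈ F_s`. -/
theorem meta_theorem_part_two
    (P : Measure PathSpace) [IsProbabilityMeasure P]
    (Γ : NNReal → PathSpace → ℝ)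
    (hΓ_meas : ∀ t : NNReal, Measurable (Γ t))
    (hΓ_nonneg : ∀ (t : NNReal) (ω : PathSpace), 0 ≤ Γ t ω)
    (hΓ_int : ∀ t : NNReal, 0 < t → Integrable (Γ t) P)
    (hΓ_pos : ∀ t : NNReal, 0 < t → 0 < ∫ ω, Γ t ω ∂P)
    (M : NNReal → PathSpace → ℝ)
    (hM_int : ∀ s : NNReal, Integrable (M s) P)
    (hM_mean : ∀ s : NNReal, ∫ ω, M s ω ∂P = 1)
    (h_conv : ∀ s : NNReal, ∀ᵐ ω ∂P,
      Tendsto (fun t : NNReal => (P[Γ t | natFiltration s]) ω / ∫ ω', Γ t ω' ∂P)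
        atTop (𝓝 (M s ω))) :
    ∃ Q : Measure PathSpace, IsProbabilityMeasure Q ∧
      ∀ (s : NNReal) (Λ : Set PathSpace), MeasurableSet[natFiltration s] Λ →
        Q Λ = ENNReal.ofReal (∫ ω in Λ, M s ω ∂P) := by
  have hpos (k : ℕ) : (0 : ℝ≥0) < k + 1 := by positivity
  let Z (s : ℝ≥0) (k : ℕ) (ω : PathSpace) : ℝ :=
    (P[Γ (k + 1) | natFiltration s]) ω / ∫ ω', Γ (k + 1) ω' ∂P
  have hZ_int (s k) : Integrable (Z s k) P := integrable_condExp.div_const _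
  have hZ_nonneg (s k) : 0 ≤ᵐ[P] Z s k := by
    filter_upwards [condExp_nonneg (m := natFiltration s)
      (Eventually.of_forall (hΓ_nonneg (k + 1)) : 0 ≤ᵐ[P] Γ (k + 1))] with ω hω
    exact div_nonneg hω (hΓ_pos _ (hpos k)).le
  have hsucc : Tendsto (fun k : ℕ ↦ (k : ℝ≥0) + 1) atTop atTop :=
    tendsto_atTop_mono (fun _ ↦ le_self_add) tendsto_natCast_atTop_atTop
  have hZ_lim (s) : ∀ᵐ ω ∂P, Tendsto (fun k ↦ Z s k ω) atTop (𝓝 (M s ω)) := by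
    filter_upwards [h_conv s] with ω hω
    exact hω.comp hsucc
  have hZ_set (s k) {Λ : Set PathSpace} (hΛ : MeasurableSet[natFiltration s] Λ) :
      ∫ ω in Λ, Z s k ω ∂P = (∫ ω in Λ, Γ (k + 1) ω ∂P) / ∫ ω, Γ (k + 1) ω ∂P := by
    rw [integral_div, setIntegral_condExp (natFiltration_le s) (hΓ_int _ (hpos k)) hΛ]
  have hM_nonneg (s) : 0 ≤ᵐ[P] M s := by
    filter_upwards [hZ_lim s, ae_all_iff.2 (hZ_nonneg s)] with ω hω h0
    exact ge_of_tendsto' hω h0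
  have hM_set (s) {Λ : Set PathSpace} (hΛ : MeasurableSet[natFiltration s] Λ) :
      Tendsto (fun k : ℕ ↦ (∫ ω in Λ, Γ (k + 1) ω ∂P) / ∫ ω, Γ (k + 1) ω ∂P) atTop
        (𝓝 (∫ ω in Λ, M s ω ∂P)) := by
    simp_rw [← hZ_set s _ hΛ]
    refine tendsto_setIntegral_of_L1 _ (hM_int s).aestronglyMeasurable
      (Eventually.of_forall (hZ_int s)) ?_ Λ
    refine tendsto_lintegral_enorm_sub_of_integral_eq (hZ_int s) (hZ_nonneg s) (hM_int s)
      (hZ_lim s) fun k ↦ ?_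
    rw [hM_mean, ← setIntegral_univ, hZ_set s k .univ, setIntegral_univ,
      div_self (hΓ_pos _ (hpos k)).ne']
  have hM_consistent {s t : ℝ≥0} (hst : s ≤ t) {Λ : Set PathSpace}
      (hΛ : MeasurableSet[natFiltration s] Λ) : ∫ ω in Λ, M s ω ∂P = ∫ ω in Λ, M t ω ∂P :=
    tendsto_nhds_unique (hM_set s hΛ) (hM_set t (natFiltration_mono hst Λ hΛ))
  let μ (s : ℝ≥0) : Measure PathSpace := P.withDensity fun ω ↦ ENNReal.ofReal (M s ω)
  have hμ (s) {Λ : Set PathSpace} (hΛ : MeasurableSet Λ) :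
      μ s Λ = ENNReal.ofReal (∫ ω in Λ, M s ω ∂P) := by
    rw [withDensity_apply _ hΛ, ofReal_integral_eq_lintegral_ofReal (hM_int s).integrableOn
      (ae_restrict_of_ae (hM_nonneg s))]
  have hμ_prob (s) : IsProbabilityMeasure (μ s) :=
    ⟨by rw [hμ s .univ, setIntegral_univ, hM_mean, ENNReal.ofReal_one]⟩
  let ν (n : ℕ) : ProbabilityMeasure PathSpace :=
    ⟨(μ n).map (stopPath n), Measure.isProbabilityMeasure_map (measurable_stopPath n).aemeasurable⟩
  obtain ⟨Q, hQ⟩ := exists_probabilityMeasure_map_stopPath_eq ν <| by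
    intro n m hnm
    have hnm' : (n : ℝ≥0) ≤ m := by exact_mod_cast hnm
    change ((μ m).map (stopPath m)).map (stopPath n) = (μ n).map (stopPath n)
    rw [Measure.map_map (measurable_stopPath n) (measurable_stopPath m),
      stopPath_comp_stopPath hnm']
    ext Λ hΛ
    rw [Measure.map_apply (measurable_stopPath n) hΛ, Measure.map_apply (measurable_stopPath n) hΛ,
      hμ _ (measurable_stopPath n hΛ), hμ _ (measurable_stopPath n hΛ),
      hM_consistent hnm' (measurableSet_stopPath_preimage n hΛ)]
  refine ⟨Q, inferInstance, fun s Λ hΛ ↦ ?_⟩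
  obtain ⟨n, hn⟩ := exists_nat_ge s
  have hΛ' : MeasurableSet Λ := natFiltration_le s Λ hΛ
  calc (Q : Measure PathSpace) Λ = (Q : Measure PathSpace).map (stopPath n) Λ := by
        rw [Measure.map_apply (measurable_stopPath n) hΛ', stopPath_preimage_eq hn hΛ]
    _ = (μ n).map (stopPath n) Λ := by rw [hQ n]; rfl
    _ = ENNReal.ofReal (∫ ω in Λ, M s ω ∂P) := by
        rw [Measure.map_apply (measurable_stopPath n) hΛ', stopPath_preimage_eq hn hΛ, hμ _ hΛ',
          hM_consistent hn hΛ]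

end
end
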